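/- arXiv:2603.07722 — 2 statements merged into one kernel-verified Lean document; each statement's English description precedes it below -/
import Mathlib

section
/- Sufficient condition for membership in the identified set via the Aumann integral under integrable boundedness (Lemma B.5). Suppose Assumptions 1 and 2 hold. For any F ∈ 𝓕 and θ ∈ Θ, if 0 belongs to the closure of the convex hull of the Aumann integral 𝔼_I(θ,F), then θ ∈ Θ_I(F). -/
open MeasureTheory Set
open scoped ENNReal RealInnerProductSpace

noncomputable section

/-- The positive part of an extended real, as an extended nonnegative real. -/
def EReal.posPart (x : EReal) : ℝ≥0∞ := if x = ⊤ then ⊤ else ENNReal.ofReal x.toReal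

/-- The integral of an `EReal`-valued function: the integral of its positive part
minus the integral of its negative part (an element of `EReal`). -/
def integralEReal {𝓩 : Type*} [MeasurableSpace 𝓩] (F : Measure 𝓩) (f : 𝓩 → EReal) : EReal :=
  ((∫⁻ z, (f z).posPart ∂F : ℝ≥0∞) : EReal) - ((∫⁻ z, (-(f z)).posPart ∂F : ℝ≥0∞) : EReal)

variable {𝓤 𝓩 : Type*}
  [MeasurableSpace 𝓤] [TopologicalSpace 𝓤] [PolishSpace 𝓤] [BorelSpace 𝓤]
  [MeasurableSpace 𝓩] [TopologicalSpace 𝓩] [PolishSpace 𝓩] [BorelSpace 𝓩]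
  {Θ : Type*}

/-- The section `Γ(z;θ) = {u : (u,z) ∈ Γ(θ)}`. -/
def sectionSet (Γθ : Set (𝓤 × 𝓩)) (z : 𝓩) : Set 𝓤 := {u | (u, z) ∈ Γθ}

/-- The set `𝓡(z;θ)` of moment values consistent with the support restriction at `z`. -/
def momentSet {d : ℕ} (Γθ : Set (𝓤 × 𝓩)) (rθ : 𝓤 → 𝓩 → EuclideanSpace ℝ (Fin d)) (z : 𝓩) :
    Set (EuclideanSpace ℝ (Fin d)) := (fun u => rθ u z) '' sectionSet Γθ z

/-- The support function `γ(λ,z;θ) = sup {λᵀt : t ∈ 𝓡(z;θ)}`, with values in `EReal`. -/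
def suppFun {d : ℕ} (Γθ : Set (𝓤 × 𝓩)) (rθ : 𝓤 → 𝓩 → EuclideanSpace ℝ (Fin d))
    (l : EuclideanSpace ℝ (Fin d)) (z : 𝓩) : EReal :=
  sSup ((fun t => ((⟪l, t⟫ : ℝ) : EReal)) '' momentSet Γθ rθ z)

/-- Assumption 1 at a single parameter value and a single distribution. -/
structure Assumption1At {d : ℕ} (F : Measure 𝓩) (Γθ : Set (𝓤 × 𝓩))
    (rθ : 𝓤 → 𝓩 → EuclideanSpace ℝ (Fin d)) : Prop where
  borel_Gamma : MeasurableSet Γθ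
  nonempty_section : ∀ z, (sectionSet Γθ z).Nonempty
  borel_section : ∀ z, MeasurableSet (sectionSet Γθ z)
  measurable_r : Measurable fun p : 𝓤 × 𝓩 => rθ p.1 p.2
  lower_envelope : ∃ g : 𝓩 → ℝ, Measurable g ∧ Integrable g F ∧
    ∀ᵐ z ∂F, sInf (norm '' momentSet Γθ rθ z) ≤ g z

/-- Assumption 1: measurability, nonempty sections, and an integrable lower envelope for
the infimum of the norm over the moment set. -/
def Assumption1 {d : ℕ} (𝓕 : Set (Measure 𝓩)) (Γ : Θ → Set (𝓤 × 𝓩))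
    (r : Θ → 𝓤 → 𝓩 → EuclideanSpace ℝ (Fin d)) : Prop :=
  ∀ θ : Θ, ∀ F ∈ 𝓕, Assumption1At F (Γ θ) (r θ)

/-- Assumption 2 at a single parameter value and distribution: closedness and
integrable boundedness of the moment sets. -/
structure Assumption2At {d : ℕ} (F : Measure 𝓩) (Γθ : Set (𝓤 × 𝓩))
    (rθ : 𝓤 → 𝓩 → EuclideanSpace ℝ (Fin d)) : Prop where
  closed_momentSet : ∀ᵐ z ∂F, IsClosed (momentSet Γθ rθ z)
  upper_envelope : ∃ g : 𝓩 → ℝ, Measurable g ∧ Integrable g F ∧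
    ∀ᵐ z ∂F, ∀ t ∈ momentSet Γθ rθ z, ‖t‖ ≤ g z

/-- Assumption 2 (closedness and integrable boundedness). -/
def Assumption2 {d : ℕ} (𝓕 : Set (Measure 𝓩)) (Γ : Θ → Set (𝓤 × 𝓩))
    (r : Θ → 𝓤 → 𝓩 → EuclideanSpace ℝ (Fin d)) : Prop :=
  ∀ θ : Θ, ∀ F ∈ 𝓕, Assumption2At F (Γ θ) (r θ)

/-- `θ` belongs to the identified set `Θ_I(F)`: there is a Borel probability measure `H`
on `𝓤 × 𝓩` giving probability one to the support restriction, with `𝓩`-marginal `F`,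
under which the moment function is integrable with mean zero. -/
def MemIdentified {d : ℕ} (Γθ : Set (𝓤 × 𝓩)) (rθ : 𝓤 → 𝓩 → EuclideanSpace ℝ (Fin d))
    (F : Measure 𝓩) : Prop :=
  ∃ H : Measure (𝓤 × 𝓩), IsProbabilityMeasure H ∧ H Γθ = 1 ∧ H.map Prod.snd = F ∧
    Integrable (fun p : 𝓤 × 𝓩 => rθ p.1 p.2) H ∧ (∫ p : 𝓤 × 𝓩, rθ p.1 p.2 ∂H) = 0

/-- `θ` belongs to the moment closure `Θ̄_I(F)` of the identified set. -/
def MemMomentClosure {d : ℕ} (Γθ : Set (𝓤 × 𝓩)) (rθ : 𝓤 → 𝓩 → EuclideanSpace ℝ (Fin d))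
    (F : Measure 𝓩) : Prop :=
  ∀ ε : ℝ, 0 < ε → ∃ H : Measure (𝓤 × 𝓩), IsProbabilityMeasure H ∧ H Γθ = 1 ∧
    H.map Prod.snd = F ∧ Integrable (fun p : 𝓤 × 𝓩 => rθ p.1 p.2) H ∧
    ‖∫ p : 𝓤 × 𝓩, rθ p.1 p.2 ∂H‖ ≤ ε

/-- `θ` belongs to the support-function set `Θ̃(F)`:
`∫ γ(λ,z;θ) dF ≥ 0` for every `λ` in the unit sphere. -/
def MemSFSet {d : ℕ} (Γθ : Set (𝓤 × 𝓩)) (rθ : 𝓤 → 𝓩 → EuclideanSpace ℝ (Fin d))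
    (F : Measure 𝓩) : Prop :=
  ∀ l : EuclideanSpace ℝ (Fin d), ‖l‖ = 1 → (0 : EReal) ≤ integralEReal F (suppFun Γθ rθ l)


/-- The Aumann integral `𝔼_I(θ,F)`: the set of integrals `∫ f dF` over `F`-a.e.-measurable,
`F`-integrable selections `f` of the closure of the moment set `z ↦ cl 𝓡(z;θ)`. -/
def AumannIntegral {d : ℕ} (Γθ : Set (𝓤 × 𝓩)) (rθ : 𝓤 → 𝓩 → EuclideanSpace ℝ (Fin d))
    (F : Measure 𝓩) : Set (EuclideanSpace ℝ (Fin d)) :=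
  {v | ∃ f : 𝓩 → EuclideanSpace ℝ (Fin d), AEMeasurable f F ∧ Integrable f F ∧
    (∀ᵐ z ∂F, f z ∈ closure (momentSet Γθ rθ z)) ∧ (∫ z, f z ∂F) = v}

open scoped NNReal

/-- A continuous map on the Cantor set has a measurable section defined on its range. -/
theorem exists_measurable_section_of_cantorSet {Z : Type*} [TopologicalSpace Z] [T2Space Z]
    [MeasurableSpace Z] [BorelSpace Z] {q : cantorSet → Z} (hq : Continuous q) :
    ∃ s : Z → cantorSet, Measurable s ∧ ∀ z ∈ range q, q (s z) = z := by
  have : CompactSpace cantorSet := isCompact_iff_compactSpace.mp isCompact_cantorSet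
  let c₀ : cantorSet := cantorSetHomeomorphNatToBool.symm fun _ => false
  have hmin : ∀ z, ∃ c : cantorSet, (z ∈ range q → q c = z ∧ ∀ c', q c' = z → c ≤ c') ∧
      (z ∉ range q → c = c₀) := by
    intro z
    by_cases hz : z ∈ range q
    · have hcomp : IsCompact (q ⁻¹' {z}) := (isClosed_singleton.preimage hq).isCompact
      obtain ⟨c, hc, hle⟩ := hcomp.exists_isLeast hz
      exact ⟨c, fun _ => ⟨hc, fun c' hc' => hle hc'⟩, fun h => absurd hz h⟩
    · exact ⟨c₀, fun h => absurd h hz, fun _ => rfl⟩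
  choose s hs hs₀ using hmin
  refine ⟨s, ?_, fun z hz => (hs z hz).1⟩
  have hclosed : ∀ t : Set cantorSet, IsClosed t → MeasurableSet (q '' t) := fun t ht =>
    (ht.isCompact.image hq).measurableSet
  have hrange : MeasurableSet (range q) := image_univ ▸ hclosed univ isClosed_univ
  refine (MeasurableEmbedding.subtype_coe isCompact_cantorSet.measurableSet).measurable_comp_iff.1
    (measurable_of_Iic fun c => ?_)
  have : (Subtype.val ∘ s) ⁻¹' Iic c =
      q '' (Subtype.val ⁻¹' Iic c) ∪ ((range q)ᶜ ∩ {_z | (c₀ : ℝ) ≤ c}) := by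
    ext z
    by_cases hz : z ∈ range q
    · simp only [mem_preimage, Function.comp_apply, mem_Iic, mem_union, mem_image,
        mem_inter_iff, mem_compl_iff, hz, not_true, false_and, or_false]
      exact ⟨fun h => ⟨s z, h, (hs z hz).1⟩, fun ⟨c', h, h'⟩ =>
        le_trans (α := ℝ) ((hs z hz).2 c' h') h⟩
    · have hz' : z ∉ q '' (Subtype.val ⁻¹' Iic c) := fun h => hz (image_subset_range _ _ h)
      simp only [mem_preimage, Function.comp_apply, mem_Iic, mem_union, hz', false_or,
        mem_inter_iff, mem_compl_iff, hz, not_false_iff, true_and, mem_ofPred_eq, hs₀ z hz]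
  rw [this]
  exact (hclosed _ (isClosed_Iic.preimage continuous_subtype_val)).union
    (hrange.compl.inter (MeasurableSet.const _))

/-- A continuous map has a measurable section over the image of any compact metrizable set. -/
theorem IsCompact.exists_measurable_section {X Z : Type*} [TopologicalSpace X]
    [TopologicalSpace.MetrizableSpace X] [MeasurableSpace X] [BorelSpace X] [Nonempty X]
    [TopologicalSpace Z] [T2Space Z] [MeasurableSpace Z] [BorelSpace Z] {p : X → Z}
    (hp : Continuous p) {L : Set X} (hL : IsCompact L) :
    ∃ s : Z → X, Measurable s ∧ ∀ z ∈ p '' L, p (s z) = z := by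
  rcases L.eq_empty_or_nonempty with rfl | hne
  · exact ⟨fun _ => Classical.arbitrary X, measurable_const, by simp⟩
  let _ : MetricSpace X := TopologicalSpace.metrizableSpaceMetric X
  have : CompactSpace L := isCompact_iff_compactSpace.mp hL
  have : Nonempty L := hne.to_subtype
  obtain ⟨e, he, hsurj⟩ := exists_nat_bool_continuous_surjective_of_compact L
  have hφ : Continuous fun c : cantorSet => (e (cantorSetHomeomorphNatToBool c) : X) := by fun_prop
  obtain ⟨s, hs, hsec⟩ := exists_measurable_section_of_cantorSet (hp.comp hφ)
  refine ⟨_, hφ.measurable.comp hs, ?_⟩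
  rintro _ ⟨x, hx, rfl⟩
  obtain ⟨b, hb⟩ := hsurj ⟨x, hx⟩
  refine hsec _ ⟨cantorSetHomeomorphNatToBool.symm b, ?_⟩
  simp [hb]

/-- An open set containing the box `{x | ∀ i, x i ≤ n i}` of the Baire space contains a box in
which only finitely many coordinates are constrained. -/
theorem IsOpen.exists_forall_lt_le_subset {V : Set (ℕ → ℕ)} (hV : IsOpen V) {n : ℕ → ℕ}
    (h : {x | ∀ i, x i ≤ n i} ⊆ V) : ∃ k, {x : ℕ → ℕ | ∀ i < k, x i ≤ n i} ⊆ V := by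
  by_contra! hcon
  simp only [not_subset] at hcon
  choose x hx hxV using hcon
  have hcomp : IsCompact (Set.pi univ fun i => Iic (n i)) :=
    isCompact_univ_pi fun i => (finite_Iic (n i)).isCompact
  obtain ⟨a, ha, φ, hφ, hlim⟩ := hcomp.tendsto_subseq
    (x := fun k i => min (x k i) (n i)) fun k i _ => mem_Iic.2 (min_le_right _ _)
  have hlim' : Filter.Tendsto (x ∘ φ) Filter.atTop (nhds a) := by
    rw [tendsto_pi_nhds] at hlim ⊢
    intro i
    refine (hlim i).congr' ?_
    filter_upwards [Filter.eventually_gt_atTop i] with k hk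
    exact min_eq_left (hx (φ k) i (hk.trans_le (hφ.id_le k)))
  obtain ⟨k, hk⟩ := (hlim'.eventually_mem (hV.mem_nhds (h fun i => ha i trivial))).exists
  exact hxV _ hk

/-- The measure of a continuous image of the Baire space is approximated from below by the measures
of the images of compact sets. -/
theorem exists_isCompact_lt_measure_image {Z : Type*} [TopologicalSpace Z] [MeasurableSpace Z]
    {μ : Measure Z} [μ.OuterRegular] {p : (ℕ → ℕ) → Z} (hp : Continuous p) {c : ℝ≥0∞}
    (hc : c < μ (range p)) : ∃ L : Set (ℕ → ℕ), IsCompact L ∧ c ≤ μ (p '' L) := by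
  have step : ∀ (A : Set (ℕ → ℕ)) (k : ℕ), ∃ N : ℕ, c < μ (p '' A) →
      c < μ (p '' (A ∩ {x | x k ≤ N})) := by
    intro A k
    by_cases hA : c < μ (p '' A)
    · have hmono : Monotone fun N : ℕ => p '' (A ∩ {x | x k ≤ N}) := fun N M hNM =>
        image_mono (inter_subset_inter_right _ fun x hx => le_trans hx hNM)
      have hU : p '' A = ⋃ N : ℕ, p '' (A ∩ {x | x k ≤ N}) := by
        rw [← image_iUnion, ← inter_iUnion]
        congr 1
        exact (inter_eq_left.2 fun x _ => mem_iUnion.2 ⟨x k, le_refl (x k)⟩).symm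
      rw [hU, hmono.measure_iUnion, lt_iSup_iff] at hA
      exact hA.imp fun _ h _ => h
    · exact ⟨0, fun h => absurd h hA⟩
  choose N hN using step
  let A : ℕ → Set (ℕ → ℕ) := fun k => Nat.rec univ (fun k A => A ∩ {x | x k ≤ N A k}) k
  let n : ℕ → ℕ := fun k => N (A k) k
  have hA : ∀ k, A k = {x | ∀ i < k, x i ≤ n i} := by
    intro k
    induction k with
    | zero => simp [A]
    | succ k ih =>
      change A k ∩ {x | x k ≤ n k} = _
      rw [ih]
      ext x
      simp only [mem_inter_iff, mem_ofPred_eq, Nat.forall_lt_succ_right]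
  have hlt : ∀ k, c < μ (p '' A k) := by
    intro k
    induction k with
    | zero => simpa [A] using hc
    | succ k ih => exact hN _ _ ih
  refine ⟨{x | ∀ i, x i ≤ n i}, ?_, ?_⟩
  · convert isCompact_univ_pi fun i => (finite_Iic (n i)).isCompact using 1
    ext x
    simp [Pi.le_def]
  · rw [Set.measure_eq_iInf_isOpen]
    refine le_iInf₂ fun U hU => le_iInf fun hUo => ?_
    obtain ⟨k, hk⟩ := (hUo.preimage hp).exists_forall_lt_le_subset (image_subset_iff.1 hU)
    exact (hlt k).le.trans (measure_mono (image_subset_iff.2 (hA k ▸ hk)))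

/-- **Measurable selection.** If almost every section of a Borel set in a product of Polish spaces
is nonempty, then there is a measurable map that selects from almost every section. -/
theorem exists_measurable_selection_ae {Z V : Type*} [TopologicalSpace Z] [PolishSpace Z]
    [MeasurableSpace Z] [BorelSpace Z] [TopologicalSpace V] [PolishSpace V] [MeasurableSpace V]
    [BorelSpace V] [Nonempty V] (μ : Measure Z) [IsFiniteMeasure μ] {B : Set (Z × V)}
    (hB : MeasurableSet B) (hne : ∀ᵐ z ∂μ, ∃ v, (z, v) ∈ B) :
    ∃ s : Z → V, Measurable s ∧ ∀ᵐ z ∂μ, (z, s z) ∈ B := by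
  rcases eq_or_ne (μ univ) 0 with hμ | hμ
  · refine ⟨fun _ => Classical.arbitrary V, measurable_const, ?_⟩
    rw [Measure.measure_univ_eq_zero] at hμ
    simp [hμ]
  have hBa := hB.analyticSet
  rw [AnalyticSet] at hBa
  rcases hBa with rfl | ⟨φ, hφ, rfl⟩
  · simp at hne
    exact absurd (by simpa using hne) hμ
  have hp : Continuous fun x => (φ x).1 := continuous_fst.comp hφ
  have hrange : μ (range fun x => (φ x).1) = μ univ := by
    refine measure_congr (Filter.eventuallyEq_univ.2 ?_)
    filter_upwards [hne] with z ⟨v, x, hx⟩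
    exact ⟨x, by simp [hx]⟩
  obtain ⟨c, -, hc, hlim⟩ := exists_seq_strictMono_tendsto' (pos_iff_ne_zero.2 hμ)
  have hK : ∀ n, ∃ L : Set (ℕ → ℕ), IsCompact L ∧ c n ≤ μ ((fun x => (φ x).1) '' L) := fun n =>
    exists_isCompact_lt_measure_image hp (hrange ▸ (hc n).2)
  choose L hL hcL using hK
  choose s hs hsec using fun n => (hL n).exists_measurable_section hp
  let K : ℕ → Set Z := fun n => (fun x => (φ x).1) '' L n
  have hKm : ∀ n, MeasurableSet (K n) := fun n => ((hL n).image hp).measurableSet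
  obtain ⟨t, ht, hts⟩ := exists_measurable_piecewise (disjointed K)
    (fun n => MeasurableSet.disjointed hKm n) s hs fun i j hij z hz =>
      absurd hz (disjoint_left.1 (disjoint_disjointed K hij) hz.1 ∘ And.right)
  refine ⟨fun z => (φ (t z)).2, (continuous_snd.comp hφ).measurable.comp ht, ?_⟩
  have hunion : ∀ᵐ z ∂μ, z ∈ ⋃ n, K n := by
    have hle : μ univ ≤ μ (⋃ n, K n) :=
      le_of_tendsto' hlim fun n => (hcL n).trans (measure_mono (subset_iUnion K n))
    have := measure_compl (MeasurableSet.iUnion hKm) (measure_ne_top μ _)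
    rw [tsub_eq_zero_of_le hle] at this
    exact this
  filter_upwards [hunion] with z hz
  rw [← iUnion_disjointed, mem_iUnion] at hz
  obtain ⟨n, hn⟩ := hz
  refine ⟨t z, ?_⟩
  have := hsec n z (disjointed_subset K n hn)
  rw [← hts n hn] at this
  exact Prod.ext this rfl

/-- **Carathéodory's theorem** with a fixed number of points. -/
theorem mem_convexHull_iff_exists_fin {E : Type*} [AddCommGroup E] [Module ℝ E]
    [FiniteDimensional ℝ E] {s : Set E} {x : E} :
    x ∈ convexHull ℝ s ↔ ∃ w ∈ stdSimplex ℝ (Fin (Module.finrank ℝ E + 1)),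
      ∃ v : Fin (Module.finrank ℝ E + 1) → E, (∀ i, v i ∈ s) ∧ ∑ i, w i • v i = x := by
  constructor
  · intro hx
    have hne : s.Nonempty := convexHull_nonempty_iff.1 ⟨x, hx⟩
    obtain ⟨y, hy⟩ := hne
    obtain ⟨ι, _, z, w, hz, haff, hw, hw1, hwz⟩ := eq_pos_convex_span_of_mem_convexHull hx
    have hcard : Fintype.card ι ≤ Fintype.card (Fin (Module.finrank ℝ E + 1)) := by
      rw [Fintype.card_fin]
      exact haff.card_le_finrank_succ.trans (Nat.succ_le_succ (Submodule.finrank_le _))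
    obtain ⟨e⟩ := Function.Embedding.nonempty_of_card_le hcard
    have hw' : ∀ i, Function.extend e w (fun _ => (0 : ℝ)) (e i) = w i :=
      e.injective.extend_apply w _
    have hw₀ : ∀ j ∉ range e, Function.extend e w (fun _ => (0 : ℝ)) j = 0 := fun j hj =>
      Function.extend_apply' w _ j hj
    have hz' : ∀ i, Function.extend e z (fun _ => y) (e i) = z i := e.injective.extend_apply z _
    refine ⟨Function.extend e w (fun _ => (0 : ℝ)), ⟨fun j => ?_, ?_⟩,
      Function.extend e z fun _ => y, fun j => ?_, ?_⟩
    · by_cases hj : j ∈ range e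
      · obtain ⟨i, rfl⟩ := hj
        exact (hw' i).symm ▸ (hw i).le
      · exact (hw₀ j hj).ge
    · rw [← hw1]
      exact (Fintype.sum_of_injective e e.injective _ _ hw₀ fun i => (hw' i).symm).symm
    · by_cases hj : j ∈ range e
      · obtain ⟨i, rfl⟩ := hj
        exact (hz' i).symm ▸ hz ⟨i, rfl⟩
      · rw [Function.extend_apply' _ _ _ hj]
        exact hy
    · rw [← hwz]
      refine (Fintype.sum_of_injective e e.injective _ _ (fun j hj => ?_) fun i => ?_).symm
      · rw [hw₀ j hj, zero_smul]
      · rw [hw', hz']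
  · rintro ⟨w, ⟨hw, hw1⟩, v, hv, rfl⟩
    exact (convex_convexHull ℝ s).sum_mem (fun i _ => hw i) hw1
      fun i _ => subset_convexHull ℝ s (hv i)

/-- In a finite-dimensional space the convex hull of a compact set is compact. -/
theorem IsCompact.convexHull_of_finiteDimensional {E : Type*} [AddCommGroup E] [Module ℝ E]
    [TopologicalSpace E] [ContinuousAdd E] [ContinuousSMul ℝ E] [FiniteDimensional ℝ E]
    {s : Set E} (hs : IsCompact s) : IsCompact (convexHull ℝ s) := by
  let n := Module.finrank ℝ E + 1
  have hcomp : IsCompact (stdSimplex ℝ (Fin n) ×ˢ Set.pi univ fun _ : Fin n => s) :=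
    (isCompact_stdSimplex ℝ (Fin n)).prod (isCompact_univ_pi fun _ => hs)
  have hcont : Continuous fun a : (Fin n → ℝ) × (Fin n → E) => ∑ i, a.1 i • a.2 i := by fun_prop
  convert hcomp.image hcont using 1
  ext x
  rw [mem_convexHull_iff_exists_fin]
  simp only [mem_image, mem_prod, mem_pi, mem_univ, forall_const, Prod.exists]
  exact ⟨fun ⟨w, hw, v, hv, h⟩ => ⟨w, v, ⟨hw, hv⟩, h⟩,
    fun ⟨w, v, ⟨hw, hv⟩, h⟩ => ⟨w, hw, v, hv, h⟩⟩

/-- A decreasing sequence of nonempty closed convex subsets of a Hilbert space, the first of which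
is bounded, has nonempty intersection. -/
theorem nonempty_iInter_of_antitone_isClosed_convex {H : Type*} [NormedAddCommGroup H]
    [InnerProductSpace ℝ H] [CompleteSpace H] {D : ℕ → Set H} (hanti : Antitone D)
    (hne : ∀ n, (D n).Nonempty) (hclosed : ∀ n, IsClosed (D n)) (hconv : ∀ n, Convex ℝ (D n))
    (hbdd : Bornology.IsBounded (D 0)) : (⋂ n, D n).Nonempty := by
  have hmin : ∀ n, ∃ v ∈ D n, ∀ u ∈ D n, ‖v‖ ≤ ‖u‖ := by
    intro n
    obtain ⟨v, hv, h⟩ := exists_norm_eq_iInf_of_complete_convex (hne n) (hclosed n).isComplete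
      (hconv n) 0
    refine ⟨v, hv, fun u hu => ?_⟩
    simp only [zero_sub, norm_neg] at h
    rw [h]
    exact ciInf_le (f := fun w : D n => ‖(w : H)‖)
      ⟨0, by rintro _ ⟨w, rfl⟩; exact norm_nonneg _⟩ ⟨u, hu⟩
  choose x hx hxmin using hmin
  have hmono : Monotone fun n => ‖x n‖ ^ 2 := fun n m h =>
    pow_le_pow_left₀ (norm_nonneg _) (hxmin n _ (hanti h (hx m))) 2
  obtain ⟨R, hR⟩ := hbdd.exists_norm_le
  have hbound : BddAbove (range fun n => ‖x n‖ ^ 2) := by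
    refine ⟨R ^ 2, ?_⟩
    rintro _ ⟨n, rfl⟩
    exact pow_le_pow_left₀ (norm_nonneg _) (hR _ (hanti (Nat.zero_le n) (hx n))) 2
  have hcauchySq := (tendsto_atTop_ciSup hmono hbound).cauchySeq
  have hdist : ∀ n m, n ≤ m → ‖x m - x n‖ ^ 2 ≤ 2 * (‖x m‖ ^ 2 - ‖x n‖ ^ 2) := by
    intro n m h
    have hmid : (2⁻¹ : ℝ) • (x m + x n) ∈ D n := by
      rw [smul_add]
      exact hconv n (hanti h (hx m)) (hx n) (by norm_num) (by norm_num) (by norm_num)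
    have h1 := hxmin n _ hmid
    rw [norm_smul, Real.norm_of_nonneg (by norm_num)] at h1
    have h2 := parallelogram_law_with_norm ℝ (x m) (x n)
    nlinarith [norm_nonneg (x n), norm_nonneg (x m + x n)]
  have hcauchy : CauchySeq x := by
    rw [Metric.cauchySeq_iff'] at hcauchySq ⊢
    intro ε hε
    obtain ⟨N, hN⟩ := hcauchySq (ε ^ 2 / 2) (by positivity)
    refine ⟨N, fun n hn => ?_⟩
    have h1 := hN n hn
    rw [Real.dist_eq] at h1
    have h2 := hdist N n hn
    rw [dist_eq_norm]
    refine lt_of_pow_lt_pow_left₀ 2 hε.le ?_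
    linarith [le_abs_self (‖x n‖ ^ 2 - ‖x N‖ ^ 2)]
  obtain ⟨a, ha⟩ := cauchySeq_tendsto_of_complete hcauchy
  refine ⟨a, mem_iInter.2 fun n => (hclosed n).mem_of_tendsto ha ?_⟩
  filter_upwards [Filter.eventually_ge_atTop n] with m hm
  exact hanti hm (hx m)

/-- A continuous linear map on a Hilbert space sends bounded closed convex sets to closed sets. -/
theorem ContinuousLinearMap.isClosed_image_of_isBounded_convex {H E : Type*} [NormedAddCommGroup H]
    [InnerProductSpace ℝ H] [CompleteSpace H] [NormedAddCommGroup E] [NormedSpace ℝ E]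
    (T : H →L[ℝ] E) {S : Set H} (hclosed : IsClosed S) (hconv : Convex ℝ S)
    (hbdd : Bornology.IsBounded S) : IsClosed (T '' S) := by
  refine isClosed_of_closure_subset fun y hy => ?_
  let D : ℕ → Set H := fun n => S ∩ T ⁻¹' Metric.closedBall y (1 / (n + 1))
  obtain ⟨x, hx⟩ := nonempty_iInter_of_antitone_isClosed_convex (D := D)
    (fun n m h => inter_subset_inter_right _ (preimage_mono
      (Metric.closedBall_subset_closedBall (one_div_le_one_div_of_le (by positivity) (by gcongr)))))
    (fun n => by
      obtain ⟨_, ⟨x, hx, rfl⟩, hd⟩ := Metric.mem_closure_iff.1 hy (1 / (n + 1)) (by positivity)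
      exact ⟨x, hx, Metric.mem_closedBall'.2 hd.le⟩)
    (fun n => hclosed.inter (Metric.isClosed_closedBall.preimage T.continuous))
    (fun n => hconv.inter ((convex_closedBall y _).linear_preimage T.toLinearMap))
    (hbdd.subset inter_subset_left)
  rw [mem_iInter] at hx
  refine ⟨x, (hx 0).1, ?_⟩
  rw [← dist_le_zero]
  exact ge_of_tendsto' tendsto_one_div_add_atTop_nhds_zero_nat fun n => (hx n).2

/-- For an integrably bounded correspondence with closed convex values, the set of integrals of its
measurable selections contains the closed convex hull of each of its subsets. -/
theorem exists_ae_mem_integral_eq_of_mem_closure_convexHull {Z E : Type*} [MeasurableSpace Z]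
    {μ : Measure Z} [IsFiniteMeasure μ] [NormedAddCommGroup E] [InnerProductSpace ℝ E]
    [CompleteSpace E] {K : Z → Set E} (hclosed : ∀ᵐ z ∂μ, IsClosed (K z))
    (hconv : ∀ᵐ z ∂μ, Convex ℝ (K z)) {g : Z → ℝ} (hg : Integrable g μ)
    (hK : ∀ᵐ z ∂μ, ∀ t ∈ K z, ‖t‖ ≤ g z) {A : Set E}
    (hA : ∀ v ∈ A, ∃ f : Z → E, AEStronglyMeasurable f μ ∧ (∀ᵐ z ∂μ, f z ∈ K z) ∧
      ∫ z, f z ∂μ = v) {v : E} (hv : v ∈ closure (convexHull ℝ A)) :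
    ∃ f : Z → E, AEStronglyMeasurable f μ ∧ (∀ᵐ z ∂μ, f z ∈ K z) ∧ ∫ z, f z ∂μ = v := by
  let ω : Z → ℝ := fun z => √(|g z| + 1)
  have hωpos : ∀ z, 0 < ω z := fun z => by positivity
  have hωsq : ∀ z, ω z ^ 2 = |g z| + 1 := fun z => Real.sq_sqrt (by positivity)
  have hωm : AEStronglyMeasurable ω μ :=
    Real.continuous_sqrt.comp_aestronglyMeasurable
      (hg.abs.aestronglyMeasurable.add aestronglyMeasurable_const)
  have hω : MemLp ω 2 μ := by
    rw [memLp_two_iff_integrable_sq hωm]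
    simp only [hωsq]
    exact hg.abs.add (integrable_const 1)
  let W : Lp ℝ 2 μ := hω.toLp ω
  have hW : W =ᵐ[μ] ω := hω.coeFn_toLp
  let T : Lp E 2 μ →L[ℝ] E :=
    ContinuousLinearMap.lpPairing μ 2 2 (ContinuousLinearMap.lsmul ℝ ℝ) W
  have hT : ∀ h : Lp E 2 μ, T h = ∫ z, ω z • h z ∂μ := by
    intro h
    rw [ContinuousLinearMap.lpPairing_eq_integral]
    refine integral_congr_ae ?_
    filter_upwards [hW] with z hz
    rw [hz]
    rfl
  let S : Set (Lp E 2 μ) := {h | ∀ᵐ z ∂μ, ω z • h z ∈ K z}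
  have hSclosed : IsClosed S := by
    refine IsSeqClosed.isClosed fun u h hu hlim => ?_
    obtain ⟨ns, -, hns⟩ := (tendstoInMeasure_of_tendsto_Lp hlim).exists_seq_tendsto_ae
    filter_upwards [hns, hclosed, ae_all_iff.2 hu] with z hz hcz huz
    exact hcz.mem_of_tendsto (hz.const_smul (ω z)) (Filter.Eventually.of_forall fun i => huz (ns i))
  have hSconv : Convex ℝ S := by
    intro h₁ hh₁ h₂ hh₂ a b ha hb hab
    change ∀ᵐ z ∂μ, _
    filter_upwards [hh₁, hh₂, hconv, Lp.coeFn_add (a • h₁) (b • h₂), Lp.coeFn_smul a h₁,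
      Lp.coeFn_smul b h₂] with z h1 h2 hcz hadd ha' hb'
    rw [hadd, Pi.add_apply, ha', hb', Pi.smul_apply, Pi.smul_apply, smul_add, smul_comm _ a,
      smul_comm _ b]
    exact hcz h1 h2 ha hb hab
  have hle : ∀ z, ∀ t : E, ‖t‖ ≤ g z → ‖(ω z)⁻¹ • t‖ ≤ ω z := by
    intro z t ht
    rw [norm_smul, norm_inv, Real.norm_of_nonneg (hωpos z).le, inv_mul_le_iff₀ (hωpos z), ← sq,
      hωsq]
    linarith [le_abs_self (g z)]
  have hSbdd : Bornology.IsBounded S := by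
    refine (Metric.isBounded_iff_subset_closedBall 0).2 ⟨‖W‖, fun h hh => ?_⟩
    rw [mem_closedBall_zero_iff]
    refine Lp.norm_le_norm_of_ae_le ?_
    filter_upwards [hW, hK, hh] with z hz hKz hhz
    have := hle z _ (hKz _ hhz)
    rw [inv_smul_smul₀ (hωpos z).ne'] at this
    rwa [hz, Real.norm_of_nonneg (hωpos z).le]
  have hAS : A ⊆ T '' S := by
    intro v hv
    obtain ⟨f, hfm, hfK, rfl⟩ := hA v hv
    have hmem : MemLp (fun z => (ω z)⁻¹ • f z) 2 μ := by
      refine hω.of_le (hωm.inv₀.smul hfm) ?_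
      filter_upwards [hK, hfK] with z hKz hfz
      rw [Real.norm_of_nonneg (hωpos z).le]
      exact hle z _ (hKz _ hfz)
    have hcancel : ∀ᵐ z ∂μ, ω z • (hmem.toLp _ : Z → E) z = f z := by
      filter_upwards [hmem.coeFn_toLp] with z hz
      rw [hz, smul_inv_smul₀ (hωpos z).ne']
    refine ⟨hmem.toLp _, ?_, ?_⟩
    · change ∀ᵐ z ∂μ, _
      filter_upwards [hcancel, hfK] with z hz hfz
      rwa [hz]
    · rw [hT]
      exact integral_congr_ae hcancel
  have hsub : closure (convexHull ℝ A) ⊆ T '' S :=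
    closure_minimal (convexHull_min hAS (hSconv.linear_image T.toLinearMap))
      (T.isClosed_image_of_isBounded_convex hSclosed hSconv hSbdd)
  obtain ⟨h, hh, rfl⟩ := hsub hv
  exact ⟨fun z => ω z • h z, hωm.smul (Lp.aestronglyMeasurable h), hh, (hT h).symm⟩

/-- Mixing finitely many selections `u i` with weights `w i` that sum to one produces a probability
measure with the given marginal, whose moments are those of the weighted mean of the selections. -/
theorem memIdentified_of_selections {X Z ι : Type*} [MeasurableSpace X] [MeasurableSpace Z]
    [Fintype ι] {d : ℕ} {G : Set (X × Z)} {ρ : X → Z → EuclideanSpace ℝ (Fin d)}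
    (hG : MeasurableSet G) (hρ : Measurable fun p : X × Z => ρ p.1 p.2) {μ : Measure Z}
    [IsProbabilityMeasure μ] {g : Z → ℝ} (hg : Integrable g μ)
    (hbound : ∀ᵐ z ∂μ, ∀ t ∈ momentSet G ρ z, ‖t‖ ≤ g z) {w : ι → Z → ℝ≥0} {u : ι → Z → X}
    (hw : ∀ i, Measurable (w i)) (hu : ∀ i, Measurable (u i)) (hw1 : ∀ᵐ z ∂μ, ∑ i, w i z = 1)
    (huG : ∀ᵐ z ∂μ, ∀ i, (u i z, z) ∈ G) (hzero : ∫ z, ∑ i, w i z • ρ (u i z) z ∂μ = 0) :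
    MemIdentified G ρ μ := by
  have hpair : ∀ i, Measurable fun z => (u i z, z) := fun i => (hu i).prodMk measurable_id
  let M : ι → Measure (X × Z) := fun i =>
    (μ.withDensity fun z => (w i z : ℝ≥0∞)).map fun z => (u i z, z)
  let H : Measure (X × Z) := ∑ i, M i
  have hsnd : H.map Prod.snd = μ := by
    ext A hA
    rw [Measure.map_apply measurable_snd hA, Measure.finsetSum_apply]
    have hM : ∀ i, M i (Prod.snd ⁻¹' A) = ∫⁻ z in A, w i z ∂μ := fun i => 
      (Measure.map_apply (hpair i) (measurable_snd hA)).trans (withDensity_apply _ hA)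
    simp only [hM]
    rw [← lintegral_finsetSum _ fun i _ => (hw i).coe_nnreal_ennreal, ← setLIntegral_one]
    refine lintegral_congr_ae (ae_restrict_of_ae ?_)
    filter_upwards [hw1] with z hz
    exact_mod_cast congrArg ((↑) : ℝ≥0 → ℝ≥0∞) hz
  have hprob : IsProbabilityMeasure H := by
    refine ⟨?_⟩
    rw [← preimage_univ (f := Prod.snd), ← Measure.map_apply measurable_snd MeasurableSet.univ,
      hsnd, measure_univ]
  have hHG : ∀ᵐ p ∂H, p ∈ G := by
    rw [ae_iff, Measure.finsetSum_apply]
    refine Finset.sum_eq_zero fun i _ => ?_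
    rw [← ae_iff]
    refine (ae_map_iff (hpair i).aemeasurable hG).2
      ((withDensity_absolutelyContinuous μ _).ae_le ?_)
    filter_upwards [huG] with z hz using hz i
  have hw_le : ∀ᵐ z ∂μ, ∀ i, w i z ≤ 1 := by
    filter_upwards [hw1] with z hz i
    exact hz ▸ Finset.single_le_sum (f := fun i => w i z) (fun _ _ => zero_le) (Finset.mem_univ i)
  have hint : ∀ i, Integrable (fun z => w i z • ρ (u i z) z) μ := by
    intro i
    refine hg.mono' ((hw i).smul (hρ.comp (hpair i))).aestronglyMeasurable ?_
    filter_upwards [hbound, huG, hw_le] with z hb hz hwz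
    have hle := hb _ (mem_image_of_mem (fun x => ρ x z) (hz i))
    rw [NNReal.smul_def, norm_smul, NNReal.norm_eq]
    exact (mul_le_of_le_one_left (norm_nonneg _) (hwz i)).trans hle
  have hintM : ∀ i, Integrable (fun p : X × Z => ρ p.1 p.2) (M i) := fun i =>
    (integrable_map_measure hρ.aestronglyMeasurable (hpair i).aemeasurable).2
      ((integrable_withDensity_iff_integrable_smul (hw i)).2 (hint i))
  refine ⟨H, hprob, (prob_compl_eq_zero_iff hG).1 hHG, hsnd,
    integrable_finsetSum_measure.2 fun i _ => hintM i, ?_⟩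
  rw [integral_finsetSum_measure fun i _ => hintM i, ← hzero,
    integral_finsetSum _ fun i _ => hint i]
  refine Finset.sum_congr rfl fun i _ => ?_
  rw [integral_map (hpair i).aemeasurable hρ.aestronglyMeasurable,
    integral_withDensity_eq_integral_smul (hw i)]

/-- **Lemma B.5 (sufficient condition for membership in the identified set via the Aumann
integral, under integrable boundedness).**  Under Assumptions 1 and 2, for any `F ∈ 𝓕` and
`θ ∈ Θ`, if `0` belongs to the closure of the convex hull of the Aumann integral `𝔼_I(θ,F)`,
then `θ ∈ Θ_I(F)`. -/
theorem mem_identified_of_aumann {d : ℕ}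
    (𝓕 : Set (Measure 𝓩)) (hprob : ∀ F ∈ 𝓕, IsProbabilityMeasure F)
    (Γ : Θ → Set (𝓤 × 𝓩)) (r : Θ → 𝓤 → 𝓩 → EuclideanSpace ℝ (Fin d))
    (h1 : Assumption1 𝓕 Γ r) (h2 : Assumption2 𝓕 Γ r)
    (F : Measure 𝓩) (hF : F ∈ 𝓕) (θ : Θ)
    (h0 : (0 : EuclideanSpace ℝ (Fin d)) ∈
      closure (convexHull ℝ (AumannIntegral (Γ θ) (r θ) F))) :
    MemIdentified (Γ θ) (r θ) F := by
  have := hprob F hF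
  obtain ⟨hΓ, hne, -, hr, -⟩ := h1 θ F hF
  obtain ⟨hclosed, g, -, hg, hbound⟩ := h2 θ F hF
  have hcompact : ∀ᵐ z ∂F, IsCompact (momentSet (Γ θ) (r θ) z) := by
    filter_upwards [hclosed, hbound] with z hz hb
    exact Metric.isCompact_of_isClosed_isBounded hz (isBounded_iff_forall_norm_le.2 ⟨g z, hb⟩)
  obtain ⟨f, hfm, hfK, hf0⟩ := exists_ae_mem_integral_eq_of_mem_closure_convexHull
    (K := fun z => convexHull ℝ (momentSet (Γ θ) (r θ) z))
    (hcompact.mono fun z hz => hz.convexHull_of_finiteDimensional.isClosed)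
    (Filter.Eventually.of_forall fun z => convex_convexHull ℝ _) hg
    (hbound.mono fun z hz t ht => mem_closedBall_zero_iff.1 <|
      convexHull_min (fun s hs => mem_closedBall_zero_iff.2 (hz s hs))
        (convex_closedBall (0 : EuclideanSpace ℝ (Fin d)) (g z)) ht)
    (by
      rintro v ⟨f, -, hf, hfR, rfl⟩
      refine ⟨f, hf.aestronglyMeasurable, ?_, rfl⟩
      filter_upwards [hfR, hclosed] with z hz hcz
      exact subset_convexHull ℝ _ (hcz.closure_eq ▸ hz)) h0
  let n := Module.finrank ℝ (EuclideanSpace ℝ (Fin d)) + 1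
  let f' := hfm.mk f
  have hff' : f =ᵐ[F] f' := hfm.ae_eq_mk
  have hr' : ∀ i : Fin n,
      Measurable fun p : 𝓩 × (Fin n → ℝ≥0) × (Fin n → 𝓤) => r θ (p.2.2 i) p.1 := fun i =>
    hr.comp (g := fun q : 𝓤 × 𝓩 => r θ q.1 q.2)
      (f := fun p : 𝓩 × (Fin n → ℝ≥0) × (Fin n → 𝓤) => (p.2.2 i, p.1)) (by fun_prop)
  let B : Set (𝓩 × (Fin n → ℝ≥0) × (Fin n → 𝓤)) :=
    {p | ∑ i, p.2.1 i = 1} ∩ (⋂ i, {p | (p.2.2 i, p.1) ∈ Γ θ}) ∩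
      {p | ∑ i, p.2.1 i • r θ (p.2.2 i) p.1 = f' p.1}
  have hB : MeasurableSet B := by
    refine MeasurableSet.inter (MeasurableSet.inter ?_ (MeasurableSet.iInter fun i => ?_)) ?_
    · exact measurableSet_eq_fun (by fun_prop) measurable_const
    · exact hΓ.preimage (f := fun p : 𝓩 × (Fin n → ℝ≥0) × (Fin n → 𝓤) => (p.2.2 i, p.1))
        (by fun_prop)
    · exact measurableSet_eq_fun (by fun_prop)
        (hfm.stronglyMeasurable_mk.measurable.comp measurable_fst)
  have hBne : ∀ᵐ z ∂F, ∃ v, (z, v) ∈ B := by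
    filter_upwards [hfK, hff'] with z hz hfz
    obtain ⟨w, ⟨hw, hw1⟩, t, ht, hsum⟩ := mem_convexHull_iff_exists_fin.1 hz
    choose u hu hut using ht
    refine ⟨(fun i => ⟨w i, hw i⟩, u), ⟨?_, mem_iInter.2 hu⟩, ?_⟩
    · exact NNReal.eq ((NNReal.coe_sum _ _).trans hw1)
    · change ∑ i, (⟨w i, hw i⟩ : ℝ≥0) • r θ (u i) z = f' z
      rw [← hfz, ← hsum]
      exact Finset.sum_congr rfl fun i _ => congrArg (w i • ·) (hut i)
  obtain ⟨z₀⟩ : Nonempty 𝓩 := nonempty_of_isProbabilityMeasure F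
  have : Nonempty 𝓤 := (hne z₀).nonempty
  obtain ⟨s, hs, hsB⟩ := exists_measurable_selection_ae F hB hBne
  refine memIdentified_of_selections hΓ hr hg hbound (w := fun i z => (s z).1 i)
    (u := fun i z => (s z).2 i) (fun i => by fun_prop) (fun i => by fun_prop)
    (hsB.mono fun z hz => hz.1.1) (hsB.mono fun z hz => mem_iInter.1 hz.1.2) ?_
  rw [← hf0]
  refine integral_congr_ae ?_
  filter_upwards [hsB, hff'] with z hz hfz
  rw [hfz]
  exact hz.2

end
end

section
/- Sufficient condition for membership in the identified set via an interior point of the Aumann integral (Lemma C.4). Suppose Assumption 1 holds. For any F ∈ 𝓕 and θ ∈ Θ, if 0 belongs to the interior of the closure of the convex hull of the Aumann integral 𝔼_I(θ,F), then θ ∈ Θ_I(F). -/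
open MeasureTheory Set
open scoped ENNReal RealInnerProductSpace

noncomputable section

variable {𝓤 𝓩 : Type*}
  [MeasurableSpace 𝓤] [TopologicalSpace 𝓤] [PolishSpace 𝓤] [BorelSpace 𝓤]
  [MeasurableSpace 𝓩] [TopologicalSpace 𝓩] [PolishSpace 𝓩] [BorelSpace 𝓩]
  {Θ : Type*}

section AnalyticSelection

open Filter Topology

theorem isCompact_nat_box (n : ℕ → ℕ) : IsCompact {x : ℕ → ℕ | ∀ k, x k ≤ n k} := by
  convert isCompact_univ_pi (fun k => (finite_Iic (n k)).isCompact) using 1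
  ext x
  simp [Pi.le_def]

/-- An open neighbourhood of the compact box `{x | ∀ k, x k ≤ n k}` in `ℕ → ℕ` contains the set cut
out by finitely many of its constraints. -/
theorem exists_initial_box_subset {W : Set (ℕ → ℕ)} (hW : IsOpen W) (n : ℕ → ℕ)
    (h : {x : ℕ → ℕ | ∀ k, x k ≤ n k} ⊆ W) :
    ∃ k, {x : ℕ → ℕ | ∀ i < k, x i ≤ n i} ⊆ W := by
  let _ : MetricSpace (ℕ → ℕ) := PiNat.metricSpaceNatNat
  have hK : IsCompact {x : ℕ → ℕ | ∀ k, x k ≤ n k} := isCompact_nat_box n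
  obtain ⟨δ, hδ, hsub⟩ := hK.exists_thickening_subset_open hW h
  obtain ⟨k, hk⟩ := exists_pow_lt_of_lt_one hδ (by norm_num : (1 / 2 : ℝ) < 1)
  refine ⟨k, fun y hy => hsub ?_⟩
  rw [Metric.mem_thickening_iff]
  refine ⟨fun i => if i < k then y i else 0, fun i => ?_, ?_⟩
  · dsimp only
    split_ifs with hi
    · exact hy i hi
    · exact Nat.zero_le _
  · refine lt_of_le_of_lt (PiNat.mem_cylinder_iff_dist_le.1 ?_) hk
    intro i hi
    simp [hi]

theorem measurableSet_sInf_eq {α : Type*} [MeasurableSpace α] {A : ℕ → Set α}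
    (hA : ∀ m, MeasurableSet (A m)) (n : ℕ) : MeasurableSet {z | sInf {m | z ∈ A m} = n} := by
  have : {z | sInf {m | z ∈ A m} = n} =
      (A n ∩ ⋂ m, ⋂ (_ : m < n), (A m)ᶜ) ∪ ({_z | n = 0} ∩ ⋂ m, (A m)ᶜ) := by
    ext z
    simp only [mem_ofPred_eq, mem_union, mem_inter_iff, mem_iInter, mem_compl_iff]
    constructor
    · rintro rfl
      rcases eq_empty_or_nonempty {m | z ∈ A m} with h | h
      · right
        exact ⟨by rw [h, Nat.sInf_empty], fun m hm => (h.subset hm : m ∈ (∅ : Set ℕ))⟩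
      · exact Or.inl ⟨Nat.sInf_mem h, fun m hm hmA => Nat.notMem_of_lt_sInf hm hmA⟩
    · rintro (⟨hn, hlt⟩ | ⟨rfl, h⟩)
      · exact le_antisymm (Nat.sInf_le hn) (le_csInf ⟨n, hn⟩ fun m hm =>
          not_lt.1 fun hmn => hlt m hmn hm)
      · rw [Nat.sInf_eq_zero]
        exact Or.inr (eq_empty_of_forall_notMem h)
  rw [this]
  exact ((hA n).inter (.iInter fun m => .iInter fun _ => (hA m).compl)).union
    ((MeasurableSet.const _).inter (.iInter fun m => (hA m).compl))

/-- The initial segments of the leftmost sequence in the fibre of `g` over `z`, in reverse order as for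
`PiNat.res`. -/
def leftmostInit {X : Type*} (g : (ℕ → ℕ) → X) (z : X) : ℕ → List ℕ
  | 0 => []
  | k + 1 =>
    sInf {n | ∃ x, g x = z ∧ PiNat.res x (k + 1) = n :: leftmostInit g z k} ::
      leftmostInit g z k

/-- The entries of the leftmost sequence in the fibre of `g` over `z`. -/
def leftmostPoint {X : Type*} (g : (ℕ → ℕ) → X) (z : X) (k : ℕ) : ℕ :=
  sInf {n | ∃ x, g x = z ∧ PiNat.res x (k + 1) = n :: leftmostInit g z k}

theorem res_leftmostPoint {X : Type*} (g : (ℕ → ℕ) → X) (z : X) (k : ℕ) :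
    PiNat.res (leftmostPoint g z) k = leftmostInit g z k := by
  induction k with
  | zero => rfl
  | succ k ih => rw [PiNat.res_succ, ih]; rfl

variable {X : Type*} [TopologicalSpace X]

theorem apply_leftmostPoint [T2Space X] {g : (ℕ → ℕ) → X} (hg : Continuous g) {z : X}
    (hz : z ∈ range g) : g (leftmostPoint g z) = z := by
  have key : ∀ k, ∃ x, g x = z ∧ PiNat.res x k = leftmostInit g z k := by
    intro k
    induction k with
    | zero => obtain ⟨x, hx⟩ := hz; exact ⟨x, hx, rfl⟩
    | succ k ih =>
      obtain ⟨x, hx, hxk⟩ := ih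
      exact Nat.sInf_mem (s := {n | ∃ x, g x = z ∧
        PiNat.res x (k + 1) = n :: leftmostInit g z k}) ⟨x k, x, hx, by rw [PiNat.res_succ, hxk]⟩
  choose x hx hxk using key
  have hlim : Tendsto x atTop (𝓝 (leftmostPoint g z)) := by
    rw [tendsto_pi_nhds]
    intro i
    refine tendsto_const_nhds.congr' ?_
    filter_upwards [eventually_gt_atTop i] with k hk
    have := hxk k
    rw [← res_leftmostPoint, PiNat.res_eq_res] at this
    exact (this hk).symm
  refine tendsto_nhds_unique ((hg.tendsto _).comp hlim) ?_
  simp [Function.comp_def, hx]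

variable [MeasurableSpace X] [BorelSpace X] [PolishSpace X]

/-- Capacitability: the image of `ℕ → ℕ` under a continuous map is approximated in measure by
compact subsets. -/
theorem exists_isCompact_subset_range_measure_ge (μ : Measure X) [IsFiniteMeasure μ]
    {g : (ℕ → ℕ) → X} (hg : Continuous g) {c : ℝ≥0∞} (hc : c < μ (range g)) :
    ∃ K ⊆ range g, IsCompact K ∧ c ≤ μ K := by
  have step : ∀ (P : Set (ℕ → ℕ)) (k : ℕ), c < μ (g '' P) →
      ∃ n, c < μ (g '' (P ∩ {x | x k ≤ n})) := by
    intro P k hP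
    have hU : g '' P = ⋃ n : ℕ, g '' (P ∩ {x | x k ≤ n}) := by
      rw [← image_iUnion, ← inter_iUnion]
      congr 1
      ext x
      simp only [mem_inter_iff, mem_iUnion, mem_ofPred_eq]
      exact ⟨fun hx => ⟨hx, x k, le_rfl⟩, fun hx => hx.1⟩
    have hmono : Monotone fun n : ℕ => g '' (P ∩ {x | x k ≤ n}) := fun a b hab =>
      image_mono (inter_subset_inter_right _ fun x (hx : x k ≤ a) => hx.trans hab)
    rw [hU, hmono.directed_le.measure_iUnion] at hP
    exact lt_iSup_iff.1 hP
  choose b hb using step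
  let Q : ℕ → {P : Set (ℕ → ℕ) // c < μ (g '' P)} := fun k =>
    Nat.rec ⟨univ, by rwa [image_univ]⟩ (fun k P => ⟨_, hb P.1 k P.2⟩) k
  let n : ℕ → ℕ := fun k => b (Q k).1 k (Q k).2
  have hQ : ∀ k, (Q k).1 = {x | ∀ i < k, x i ≤ n i} := by
    intro k
    induction k with
    | zero => ext; simp [Q]
    | succ k ih =>
      have : (Q (k + 1)).1 = (Q k).1 ∩ {x | x k ≤ n k} := rfl
      rw [this, ih]
      ext x
      simp only [mem_inter_iff, mem_ofPred_eq, Nat.lt_succ_iff_lt_or_eq, or_imp, forall_and,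
        forall_eq]
  have hK : IsCompact {x : ℕ → ℕ | ∀ k, x k ≤ n k} := isCompact_nat_box n
  refine ⟨g '' {x | ∀ k, x k ≤ n k}, image_subset_range _ _, hK.image hg, ?_⟩
  by_contra! hlt
  obtain ⟨U, hKU, hU, hμU⟩ := Set.exists_isOpen_lt_of_lt _ _ hlt
  obtain ⟨k, hk⟩ := exists_initial_box_subset (hU.preimage hg) n (image_subset_iff.1 hKU)
  have h1 := (Q k).2
  rw [hQ] at h1
  exact (h1.trans_le (measure_mono (image_subset_iff.2 hk))).not_gt hμU

/-- Analytic sets are universally measurable. -/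
theorem AnalyticSet.nullMeasurableSet {s : Set X} (hs : AnalyticSet s) (μ : Measure X)
    [IsFiniteMeasure μ] : NullMeasurableSet s μ := by
  rw [AnalyticSet] at hs
  obtain rfl | ⟨g, hg, rfl⟩ := hs
  · exact MeasurableSet.empty.nullMeasurableSet
  rcases eq_or_ne (μ (range g)) 0 with h0 | h0
  · exact NullMeasurableSet.of_null h0
  obtain ⟨c, -, hc, hlim⟩ := exists_seq_strictMono_tendsto' (bot_lt_iff_ne_bot.2 h0)
  choose K hKs hK hcK using fun n =>
    exists_isCompact_subset_range_measure_ge μ hg (hc n).2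
  have hm : MeasurableSet (⋃ n, K n) := MeasurableSet.iUnion fun n => (hK n).measurableSet
  have hle : μ (range g) ≤ μ (⋃ n, K n) :=
    le_of_tendsto' hlim fun n => (hcK n).trans (measure_mono (subset_iUnion K n))
  exact hm.nullMeasurableSet.congr
    (ae_eq_of_subset_of_measure_ge (iUnion_subset hKs) hle hm.nullMeasurableSet
      (measure_ne_top μ _))

theorem nullMeasurableSet_leftmostInit_eq (μ : Measure X) [IsFiniteMeasure μ]
    {g : (ℕ → ℕ) → X} (hg : Continuous g) (k : ℕ) (l : List ℕ) :
    NullMeasurableSet {z | leftmostInit g z k = l} μ := by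
  have hfib : ∀ (l : List ℕ) (k : ℕ),
      NullMeasurableSet {z : X | ∃ x, g x = z ∧ PiNat.res x k = l} μ := by
    intro l k
    have hopen : IsOpen {x : ℕ → ℕ | PiNat.res x k = l} := by
      refine isOpen_iff_mem_nhds.2 fun x hx => ?_
      refine Filter.mem_of_superset ((PiNat.isOpen_cylinder _ x k).mem_nhds
        (PiNat.self_mem_cylinder x k)) fun y hy => ?_
      rw [PiNat.cylinder_eq_res] at hy
      exact Eq.trans hy hx
    convert AnalyticSet.nullMeasurableSet (hopen.analyticSet_image hg) μ using 1
    ext z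
    simp [and_comm]
  induction k generalizing l with
  | zero => exact (MeasurableSet.const ([] = l)).nullMeasurableSet
  | succ k ih =>
    cases l with
    | nil => exact (MeasurableSet.const False).nullMeasurableSet.congr (by simp [leftmostInit])
    | cons n t =>
      have h := (ih t).inter (measurableSet_sInf_eq (α := NullMeasurableSpace X μ)
        (A := fun m => {z : X | ∃ x, g x = z ∧ PiNat.res x (k + 1) = m :: t})
        (fun m => hfib (m :: t) (k + 1)) n)
      convert h using 1
      ext z
      simp only [leftmostInit, mem_ofPred_eq, List.cons.injEq]
      constructor
      · rintro ⟨h1, rfl⟩; exact ⟨rfl, h1⟩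
      · rintro ⟨rfl, h1⟩; exact ⟨h1, rfl⟩

theorem nullMeasurable_leftmostPoint (μ : Measure X) [IsFiniteMeasure μ] {g : (ℕ → ℕ) → X}
    (hg : Continuous g) : NullMeasurable (leftmostPoint g) μ := by
  have : @Measurable (NullMeasurableSpace X μ) _ _ _ (leftmostPoint g) := by
    refine measurable_pi_iff.2 fun k => measurable_to_countable' fun n => ?_
    have heq : (fun z => leftmostPoint g z k) ⁻¹' {n} =
        ⋃ t, {z | leftmostInit g z (k + 1) = n :: t} := by
      ext z
      simp [leftmostInit, leftmostPoint]
    have h : NullMeasurableSet ((fun z => leftmostPoint g z k) ⁻¹' {n}) μ := by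
      rw [heq]
      exact .iUnion fun t => nullMeasurableSet_leftmostInit_eq μ hg (k + 1) (n :: t)
    exact h
  exact this

/-- A Borel set whose sections are almost surely nonempty has a Borel almost sure selection. -/
theorem exists_measurable_ae_selection {Y : Type*} [TopologicalSpace Y] [PolishSpace Y]
    [MeasurableSpace Y] [BorelSpace Y] [Nonempty Y] (μ : Measure X) [IsFiniteMeasure μ]
    {A : Set (Y × X)} (hA : MeasurableSet A) (h : ∀ᵐ x ∂μ, ∃ y, (y, x) ∈ A) :
    ∃ σ : X → Y, Measurable σ ∧ ∀ᵐ x ∂μ, (σ x, x) ∈ A := by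
  have hA' := hA.analyticSet
  rw [AnalyticSet] at hA'
  obtain rfl | ⟨φ, hφ, rfl⟩ := hA'
  · exact ⟨fun _ => Classical.arbitrary Y, measurable_const, h.mono fun x hx => by simp at hx⟩
  have hg : Continuous fun x => (φ x).2 := continuous_snd.comp hφ
  have hτ := (nullMeasurable_leftmostPoint μ hg).aemeasurable
  have hfst : Measurable fun x => (φ x).1 := (continuous_fst.comp hφ).measurable
  refine ⟨fun x => (φ (hτ.mk _ x)).1, hfst.comp hτ.measurable_mk, ?_⟩
  filter_upwards [h, hτ.ae_eq_mk] with x hx hmk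
  obtain ⟨y, t, ht⟩ := hx
  refine ⟨hτ.mk _ x, Prod.ext rfl ?_⟩
  rw [← hmk]
  exact apply_leftmostPoint hg ⟨t, congrArg Prod.snd ht⟩

end AnalyticSelection

/-- A convex set in a finite-dimensional space contains the interior of its closure. -/
theorem Convex.interior_closure_subset {E : Type*} [NormedAddCommGroup E] [NormedSpace ℝ E]
    [FiniteDimensional ℝ E] {s : Set E} (hs : Convex ℝ s) : interior (closure s) ⊆ s := by
  rcases (interior (closure s)).eq_empty_or_nonempty with h | h
  · simp [h]
  have hne : (interior s).Nonempty := by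
    rw [hs.interior_nonempty_iff_affineSpan_eq_top]
    have h1 := hs.closure.interior_nonempty_iff_affineSpan_eq_top.1 h
    rw [← top_le_iff, ← h1, affineSpan_le]
    exact closure_minimal (subset_affineSpan ℝ s) (AffineSubspace.closed_of_finiteDimensional _)
  rw [hs.interior_closure_eq_interior_of_nonempty_interior hne]
  exact interior_subset

/-- The means of the moment function under the joint distributions that satisfy the support
restriction and have the given marginal. -/
def attainableMoments {U Z : Type*} [MeasurableSpace U] [MeasurableSpace Z] {d : ℕ}
    (Γθ : Set (U × Z)) (rθ : U → Z → EuclideanSpace ℝ (Fin d)) (F : Measure Z) :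
    Set (EuclideanSpace ℝ (Fin d)) :=
  {v | ∃ H : Measure (U × Z), IsProbabilityMeasure H ∧ H Γθ = 1 ∧ H.map Prod.snd = F ∧
    Integrable (fun p : U × Z => rθ p.1 p.2) H ∧ (∫ p : U × Z, rθ p.1 p.2 ∂H) = v}

theorem convex_attainableMoments {U Z : Type*} [MeasurableSpace U] [MeasurableSpace Z] {d : ℕ}
    (Γθ : Set (U × Z)) (rθ : U → Z → EuclideanSpace ℝ (Fin d)) (F : Measure Z) :
    Convex ℝ (attainableMoments Γθ rθ F) := by
  rintro _ ⟨H₁, hp₁, hΓ₁, hF₁, hi₁, rfl⟩ _ ⟨H₂, hp₂, hΓ₂, hF₂, hi₂, rfl⟩ a b ha hb hab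
  have hab' : ENNReal.ofReal a + ENNReal.ofReal b = 1 := by
    rw [← ENNReal.ofReal_add ha hb, hab, ENNReal.ofReal_one]
  refine ⟨ENNReal.ofReal a • H₁ + ENNReal.ofReal b • H₂, ⟨?_⟩, ?_, ?_, ?_, ?_⟩
  · simp [hab']
  · simp [hΓ₁, hΓ₂, hab']
  · rw [Measure.map_add _ _ measurable_snd, Measure.map_smul, Measure.map_smul, hF₁, hF₂,
      ← add_smul, hab', one_smul]
  · exact (hi₁.smul_measure ENNReal.ofReal_ne_top).add_measure
      (hi₂.smul_measure ENNReal.ofReal_ne_top)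
  · rw [integral_add_measure (hi₁.smul_measure ENNReal.ofReal_ne_top)
      (hi₂.smul_measure ENNReal.ofReal_ne_top), integral_smul_measure, integral_smul_measure,
      ENNReal.toReal_ofReal ha, ENNReal.toReal_ofReal hb]

theorem aumannIntegral_subset_closure_attainableMoments {d : ℕ} {Γθ : Set (𝓤 × 𝓩)}
    {rθ : 𝓤 → 𝓩 → EuclideanSpace ℝ (Fin d)} (F : Measure 𝓩) [IsProbabilityMeasure F]
    (hΓ : MeasurableSet Γθ) (hr : Measurable fun p : 𝓤 × 𝓩 => rθ p.1 p.2) :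
    AumannIntegral Γθ rθ F ⊆ closure (attainableMoments Γθ rθ F) := by
  rintro _ ⟨f, hf, hfi, hmem, rfl⟩
  refine Metric.mem_closure_iff.2 fun ε hε => ?_
  have hA : MeasurableSet (Γθ ∩ {p : 𝓤 × 𝓩 | ‖rθ p.1 p.2 - hf.mk f p.2‖ < ε / 2}) :=
    hΓ.inter (measurableSet_lt (hr.sub (hf.measurable_mk.comp measurable_snd)).norm
      measurable_const)
  have hex : ∀ᵐ z ∂F, ∃ u, (u, z) ∈ Γθ ∩ {p : 𝓤 × 𝓩 | ‖rθ p.1 p.2 - hf.mk f p.2‖ < ε / 2} := by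
    filter_upwards [hmem, hf.ae_eq_mk] with z hz hmk
    obtain ⟨_, ⟨u, hu, rfl⟩, hdist⟩ := Metric.mem_closure_iff.1 hz (ε / 2) (half_pos hε)
    refine ⟨u, hu, ?_⟩
    rwa [dist_comm, dist_eq_norm, hmk] at hdist
  have : Nonempty 𝓤 := hex.exists.elim fun _ h => h.elim fun u _ => ⟨u⟩
  obtain ⟨σ, hσ, hσA⟩ := exists_measurable_ae_selection F hA hex
  have hgraph : Measurable fun z => (σ z, z) := hσ.prodMk measurable_id
  have hrm : Measurable fun z => rθ (σ z) z := hr.comp hgraph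
  have hbound : ∀ᵐ z ∂F, ‖rθ (σ z) z - f z‖ ≤ ε / 2 := by
    filter_upwards [hσA, hf.ae_eq_mk] with z hz hmk
    rw [hmk]
    exact hz.2.le
  have hdiff : Integrable (fun z => rθ (σ z) z - f z) F :=
    .of_bound (hrm.aestronglyMeasurable.sub hfi.aestronglyMeasurable) _ hbound
  have hri : Integrable (fun z => rθ (σ z) z) F :=
    (hdiff.add hfi).congr (.of_forall fun z => sub_add_cancel (rθ (σ z) z) (f z))
  refine ⟨∫ z, rθ (σ z) z ∂F, ⟨F.map fun z => (σ z, z),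
    Measure.isProbabilityMeasure_map hgraph.aemeasurable, ?_, ?_, ?_, ?_⟩, ?_⟩
  · rw [Measure.map_apply hgraph hΓ, prob_compl_eq_zero_iff (hgraph hΓ) |>.symm]
    exact hσA.mono fun z hz => hz.1
  · rw [Measure.map_map measurable_snd hgraph]
    exact Measure.map_id
  · exact (integrable_map_measure hr.aestronglyMeasurable hgraph.aemeasurable).2 hri
  · exact integral_map hgraph.aemeasurable hr.aestronglyMeasurable
  · rw [dist_comm, dist_eq_norm, ← integral_sub hri hfi]
    calc ‖∫ z, (rθ (σ z) z - f z) ∂F‖ ≤ ε / 2 * F.real univ :=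
          norm_integral_le_of_norm_le_const hbound
      _ < ε := by simpa using half_lt_self hε

/-- **Lemma C.4 (membership in the identified set via an interior point of the Aumann
integral).**  Under Assumption 1, for any `F ∈ 𝓕` and `θ ∈ Θ`, if `0` belongs to the interior
of the closure of the convex hull of the Aumann integral `𝔼_I(θ,F)`, then `θ ∈ Θ_I(F)`. -/
theorem mem_identified_of_aumann_interior {d : ℕ}
    (𝓕 : Set (Measure 𝓩)) (hprob : ∀ F ∈ 𝓕, IsProbabilityMeasure F)
    (Γ : Θ → Set (𝓤 × 𝓩)) (r : Θ → 𝓤 → 𝓩 → EuclideanSpace ℝ (Fin d))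
    (h1 : Assumption1 𝓕 Γ r)
    (F : Measure 𝓩) (hF : F ∈ 𝓕) (θ : Θ)
    (h0 : (0 : EuclideanSpace ℝ (Fin d)) ∈
      interior (closure (convexHull ℝ (AumannIntegral (Γ θ) (r θ) F)))) :
    MemIdentified (Γ θ) (r θ) F := by
  have := hprob F hF
  have hconv := convex_attainableMoments (Γ θ) (r θ) F
  have hsub : closure (convexHull ℝ (AumannIntegral (Γ θ) (r θ) F)) ⊆
      closure (attainableMoments (Γ θ) (r θ) F) :=
    closure_minimal (convexHull_min (aumannIntegral_subset_closure_attainableMoments F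
      (h1 θ F hF).borel_Gamma (h1 θ F hF).measurable_r) hconv.closure) isClosed_closure
  exact hconv.interior_closure_subset (interior_mono hsub h0)

end
end
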